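/- For every natural number n ≥ 1, the (n−1)-st derivative of the function l(x) = (n−1)!·f_n(x)·((2−2n)x − x² − n(n−1)) + x^{n+1} + (n−1)·x^n equals (n−1)!·x²·e^{−x} for every real x ≥ 0, and moreover l^{(j)}(0) = 0 for every j with 0 ≤ j ≤ n−1. -/

import Mathlib

/-- The signed tail of the Taylor series of `e^{-x}`:
`f k x = (-1)^k ∑_{j=k}^∞ (-x)^j / j!`. -/
noncomputable def f (k : ℕ) (x : ℝ) : ℝ :=
  (-1 : ℝ) ^ k * ∑' j : ℕ, (-x) ^ (k + j) / (Nat.factorial (k + j))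

/-- `l n x = (n-1)! f_n(x) ((2-2n)x - x² - n(n-1)) + x^{n+1} + (n-1) x^n`. -/
noncomputable def l (n : ℕ) (x : ℝ) : ℝ :=
  (Nat.factorial (n - 1)) * f n x *
      ((2 - 2 * (n : ℝ)) * x - x ^ 2 - (n : ℝ) * ((n : ℝ) - 1)) +
    x ^ (n + 1) + ((n : ℝ) - 1) * x ^ n

lemma f_zero (x : ℝ) : f 0 x = Real.exp (-x) := by
  rw [Real.exp_eq_exp_ℝ, NormedSpace.exp_eq_tsum_div]
  simp [f]

lemma f_succ (k : ℕ) (x : ℝ) : f (k + 1) x = x ^ k / (k.factorial : ℝ) - f k x := by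
  have hs : Summable (fun j : ℕ => (-x) ^ (k + j) / ((Nat.factorial (k + j) : ℕ) : ℝ)) := by
    have h := (summable_nat_add_iff k).2 (Real.summable_pow_div_factorial (-x))
    refine h.congr fun j => ?_
    rw [add_comm]
  unfold f
  rw [hs.tsum_eq_zero_add]
  have e : ∀ j : ℕ, (-x) ^ (k + 1 + j) / ((Nat.factorial (k + 1 + j) : ℕ) : ℝ)
      = (-x) ^ (k + (j + 1)) / ((Nat.factorial (k + (j + 1)) : ℕ) : ℝ) := by
    intro j
    rw [show k + 1 + j = k + (j + 1) by ring]
  rw [tsum_congr e]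
  have h2 : (-1 : ℝ) ^ k * (-x) ^ k = x ^ k := by
    rw [← mul_pow]; simp
  rw [add_zero, mul_add, ← mul_div_assoc, h2, pow_succ]
  ring

lemma hasDerivAt_f (k : ℕ) (x : ℝ) : HasDerivAt (f (k + 1)) (f k x) x := by
  induction k with
  | zero =>
    have h : f (0 + 1) = fun x => 1 - Real.exp (-x) := by
      funext y
      rw [f_succ, f_zero]; simp
    rw [h, f_zero]
    have := ((hasDerivAt_neg x).exp).const_sub 1
    simpa using this
  | succ k ih =>
    have h : f (k + 1 + 1) = fun x => x ^ (k + 1) / ((k + 1).factorial : ℝ) - f (k + 1) x := by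
      funext y
      rw [f_succ]
    rw [h]
    have := ((hasDerivAt_pow (k + 1) x).div_const ((k + 1).factorial : ℝ)).sub ih
    refine this.congr_deriv ?_
    rw [f_succ, Nat.factorial_succ]
    have : (k.factorial : ℝ) ≠ 0 := by positivity
    push_cast
    field_simp

lemma f_at_zero (k : ℕ) : f (k + 1) 0 = 0 := by
  induction k with
  | zero => rw [f_succ, f_zero]; simp
  | succ k ih => rw [f_succ, ih]; simp

lemma iter_l (j : ℕ) : ∀ i m : ℕ, m = i + j → iteratedDeriv j (l (m + 1)) = fun x : ℝ =>
    (m.factorial : ℝ) * (-(x ^ 2 + 2 * m * x + m * (m + 1)) * f (i + 1) x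
      - j * (2 * x + 2 * m) * f (i + 2) x - j * (j - 1) * f (i + 3) x)
    + ((m + 2).factorial : ℝ) / ((i + 2).factorial : ℝ) * x ^ (i + 2)
    + m * (((m + 1).factorial : ℝ) / ((i + 1).factorial : ℝ)) * x ^ (i + 1) := by
  induction j with
  | zero =>
    intro i m h
    obtain rfl : m = i := by simpa using h
    funext x
    have h1 : ((m + 2).factorial : ℝ) ≠ 0 := by positivity
    have h2 : ((m + 1).factorial : ℝ) ≠ 0 := by positivity
    rw [iteratedDeriv_zero, l, div_self h1, div_self h2]
    simp only [Nat.add_sub_cancel]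
    push_cast
    ring
  | succ j ih =>
    intro i m h
    rw [iteratedDeriv_succ, ih (i + 1) m (by omega)]
    funext x
    apply HasDerivAt.deriv
    have d1 := hasDerivAt_f (i + 1) x
    have d2 := hasDerivAt_f (i + 2) x
    have d3 := hasDerivAt_f (i + 3) x
    have p0 : HasDerivAt (fun x : ℝ => -(x ^ 2 + 2 * m * x + m * (m + 1))) (-(2 * x + 2 * m)) x := by
      have := (((hasDerivAt_pow 2 x).add ((hasDerivAt_id x).const_mul (2 * (m : ℝ)))).add_const
        ((m : ℝ) * (m + 1))).neg
      refine this.congr_deriv ?_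
      simp
    have p1 : HasDerivAt (fun x : ℝ => (j : ℝ) * (2 * x + 2 * m)) (j * 2) x := by
      have := ((((hasDerivAt_id x).const_mul (2 : ℝ))).add_const
        (2 * (m : ℝ))).const_mul (j : ℝ)
      refine this.congr_deriv ?_
      simp
    have q1 := (hasDerivAt_pow (i + 3) x).const_mul
      (((m + 2).factorial : ℝ) / ((i + 3).factorial : ℝ))
    have q2 := (hasDerivAt_pow (i + 2) x).const_mul
      ((m : ℝ) * (((m + 1).factorial : ℝ) / ((i + 2).factorial : ℝ)))
    have D := (((((p0.mul d1).sub (p1.mul d2)).sub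
      (d3.const_mul ((j : ℝ) * (j - 1)))).const_mul (m.factorial : ℝ)).add q1).add q2
    refine D.congr_deriv ?_
    rw [Nat.factorial_succ (i + 2), Nat.factorial_succ (i + 1)]
    have h2 : ((i + 1).factorial : ℝ) ≠ 0 := by positivity
    have h3 : (i : ℝ) + 1 + 1 ≠ 0 := by positivity
    have h4 : (i : ℝ) + 2 + 1 ≠ 0 := by positivity
    simp only [show i + 3 - 1 = i + 2 by omega, show i + 2 - 1 = i + 1 by omega]
    push_cast
    field_simp
    ring

theorem stmt_10 (n : ℕ) (hn : 1 ≤ n) :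
    (∀ x : ℝ, 0 ≤ x →
      iteratedDeriv (n - 1) (l n) x =
        (Nat.factorial (n - 1)) * x ^ 2 * Real.exp (-x)) ∧
    (∀ j : ℕ, j ≤ n - 1 → iteratedDeriv j (l n) 0 = 0) := by
  obtain ⟨m, rfl⟩ : ∃ m, n = m + 1 := ⟨n - 1, by omega⟩
  simp only [Nat.add_sub_cancel]
  constructor
  · intro x _
    rw [iter_l m 0 m (by simp)]
    simp only [f_succ, f_zero, zero_add, Nat.factorial_succ, Nat.factorial_zero]
    push_cast
    field_simp
    ring
  · intro j hj
    rw [iter_l j (m - j) m (by omega)]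
    simp [f_at_zero (m - j), f_at_zero (m - j + 1), f_at_zero (m - j + 2)]
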